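/- arXiv:1408.1967 — 2 statements merged into one kernel-verified Lean document; each statement's English description precedes it below -/
import Mathlib

section
/- Let a, b ≥ 1 be natural numbers, let α be a string, let T be a leaf bag that is (a+b−1)-bushy from α, and let P ⊆ T. Then there is a subset S of T such that S is a leaf bag which is a-bushy from α for P, or S is a leaf bag which is b-bushy from α for T \ P. -/
/-- A leaf bag: a finite nonempty set of pairwise incomparable strings
(no element is a prefix of another). -/
def IsLeafBag (T : Finset (List ℕ)) : Prop :=
  T.Nonempty ∧ ∀ σ ∈ T, ∀ τ ∈ T, σ ≠ τ → ¬ σ <+: τ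

/-- `T` is an `n`-bushy leaf bag from the string `α`: every element of `T` extends `α`,
and every string `τ` with `α ⊆ τ ⊂ ρ` for some `ρ ∈ T` has at least `n` immediate
successors which are prefixes of elements of `T`. -/
def BushyFrom (n : ℕ) (α : List ℕ) (T : Finset (List ℕ)) : Prop :=
  IsLeafBag T ∧ (∀ τ ∈ T, α <+: τ) ∧
  ∀ τ : List ℕ, α <+: τ → (∃ ρ ∈ T, τ <+: ρ ∧ τ ≠ ρ) →
    ∃ S : Finset ℕ, n ≤ S.card ∧ ∀ k ∈ S, ∃ ρ ∈ T, (τ ++ [k]) <+: ρ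

/-- `T` is `n`-bushy from `α` for the set of strings `P`. -/
def BushyFromFor (n : ℕ) (α : List ℕ) (P : Set (List ℕ)) (T : Finset (List ℕ)) : Prop :=
  BushyFrom n α T ∧ ↑T ⊆ P

theorem eq_of_append_singleton_prefix {α τ : List ℕ} {j k : ℕ}
    (hj : α ++ [j] <+: τ) (hk : α ++ [k] <+: τ) : j = k := by
  have h := List.prefix_of_prefix_length_le hj hk (by simp)
  simpa using h.eq_of_length (by simp)

theorem eq_or_exists_append_singleton_prefix {α τ : List ℕ} (h : α <+: τ) :
    τ = α ∨ ∃ k, α ++ [k] <+: τ := by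
  obtain ⟨_ | ⟨k, t⟩, rfl⟩ := h
  · simp
  · exact Or.inr ⟨k, t, by simp⟩

theorem bushyFrom_singleton (n : ℕ) (α : List ℕ) : BushyFrom n α {α} := by
  refine ⟨⟨by simp, by simp +contextual⟩, by simp, ?_⟩
  rintro τ hατ ⟨ρ, hρ, hτρ, hne⟩
  rw [Finset.mem_singleton] at hρ
  subst hρ
  exact absurd (hτρ.eq_of_length_le hατ.length_le) hne

/-- The part of a bushy leaf bag above an immediate successor is bushy from that successor. -/
theorem BushyFrom.filter {n : ℕ} {α : List ℕ} {T : Finset (List ℕ)} (hT : BushyFrom n α T)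
    {k : ℕ} (hk : ∃ ρ ∈ T, α ++ [k] <+: ρ) :
    BushyFrom n (α ++ [k]) (T.filter fun τ => α ++ [k] <+: τ) := by
  obtain ⟨⟨-, hanti⟩, -, hbushy⟩ := hT
  refine ⟨⟨?_, ?_⟩, ?_, ?_⟩
  · obtain ⟨ρ, hρ, hkρ⟩ := hk
    exact ⟨ρ, Finset.mem_filter.2 ⟨hρ, hkρ⟩⟩
  · exact fun σ hσ τ hτ => hanti σ (Finset.mem_filter.1 hσ).1 τ (Finset.mem_filter.1 hτ).1
  · exact fun τ hτ => (Finset.mem_filter.1 hτ).2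
  · rintro τ hτ ⟨ρ, hρ, h⟩
    obtain ⟨S, hS, hST⟩ := hbushy τ ((List.prefix_append _ _).trans hτ)
      ⟨ρ, (Finset.mem_filter.1 hρ).1, h⟩
    refine ⟨S, hS, fun j hj => ?_⟩
    obtain ⟨ρ', hρ', hj'⟩ := hST j hj
    exact ⟨ρ', Finset.mem_filter.2 ⟨hρ', hτ.trans ((List.prefix_append _ _).trans hj')⟩, hj'⟩

/-- Leaf bags that are bushy from at least `n` immediate successors of `α` combine to a leaf bag
that is bushy from `α`. -/
theorem BushyFrom.biUnion {n : ℕ} {α : List ℕ} {K : Finset ℕ} (hK : K.Nonempty)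
    (hn : n ≤ K.card) {F : ℕ → Finset (List ℕ)} (hF : ∀ k ∈ K, BushyFrom n (α ++ [k]) (F k)) :
    BushyFrom n α (K.biUnion F) := by
  refine ⟨⟨?_, ?_⟩, ?_, ?_⟩
  · exact hK.biUnion fun k hk => (hF k hk).1.1
  · intro σ hσ τ hτ hne hστ
    obtain ⟨j, hj, hσ⟩ := Finset.mem_biUnion.1 hσ
    obtain ⟨k, hk, hτ⟩ := Finset.mem_biUnion.1 hτ
    obtain rfl := eq_of_append_singleton_prefix (((hF j hj).2.1 σ hσ).trans hστ)
      ((hF k hk).2.1 τ hτ)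
    exact (hF j hj).1.2 σ hσ τ hτ hne hστ
  · intro τ hτ
    obtain ⟨k, hk, hτ⟩ := Finset.mem_biUnion.1 hτ
    exact (List.prefix_append _ _).trans ((hF k hk).2.1 τ hτ)
  · rintro τ hτ ⟨ρ, hρ, hτρ, hne⟩
    obtain ⟨k, hk, hρ⟩ := Finset.mem_biUnion.1 hρ
    obtain rfl | ⟨j, hj⟩ := eq_or_exists_append_singleton_prefix hτ
    · refine ⟨K, hn, fun i hi => ?_⟩
      obtain ⟨σ, hσ⟩ := (hF i hi).1.1
      exact ⟨σ, Finset.mem_biUnion.2 ⟨i, hi, hσ⟩, (hF i hi).2.1 σ hσ⟩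
    · obtain rfl := eq_of_append_singleton_prefix (hj.trans hτρ) ((hF k hk).2.1 ρ hρ)
      obtain ⟨S, hS, hST⟩ := (hF j hk).2.2 τ hj ⟨ρ, hρ, hτρ, hne⟩
      refine ⟨S, hS, fun i hi => ?_⟩
      obtain ⟨σ, hσ, hiσ⟩ := hST i hi
      exact ⟨σ, Finset.mem_biUnion.2 ⟨j, hk, hσ⟩, hiσ⟩

theorem BushyFromFor.biUnion {n : ℕ} {α : List ℕ} {P : Set (List ℕ)} {K : Finset ℕ}
    (hK : K.Nonempty) (hn : n ≤ K.card) {F : ℕ → Finset (List ℕ)}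
    (hF : ∀ k ∈ K, BushyFromFor n (α ++ [k]) P (F k)) :
    BushyFromFor n α P (K.biUnion F) := by
  refine ⟨.biUnion hK hn fun k hk => (hF k hk).1, fun τ hτ => ?_⟩
  obtain ⟨k, hk, hτ⟩ := Finset.mem_biUnion.1 (Finset.mem_coe.1 hτ)
  exact (hF k hk).2 hτ

theorem BushyFrom.exists_subset_or_compl {a b : ℕ} (ha : 1 ≤ a) (hb : 1 ≤ b)
    (P : Set (List ℕ)) (m : ℕ) {α : List ℕ} {T : Finset (List ℕ)}
    (hm : ∀ τ ∈ T, τ.length ≤ α.length + m) (hT : BushyFrom (a + b - 1) α T) :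
    ∃ S ⊆ T, BushyFromFor a α P S ∨ BushyFromFor b α Pᶜ S := by
  classical
  have hleaf : ∀ {α : List ℕ} {T : Finset (List ℕ)}, α ∈ T →
      ∃ S ⊆ T, BushyFromFor a α P S ∨ BushyFromFor b α Pᶜ S := by
    intro α T hα
    refine ⟨{α}, by simpa using hα, ?_⟩
    by_cases hP : α ∈ P
    · exact Or.inl ⟨bushyFrom_singleton a α, by simpa using hP⟩
    · exact Or.inr ⟨bushyFrom_singleton b α, by simpa using hP⟩
  induction m generalizing α T with
  | zero =>
    obtain ⟨ρ, hρ⟩ := hT.1.1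
    obtain rfl := (hT.2.1 ρ hρ).eq_of_length_le (hm ρ hρ)
    exact hleaf hρ
  | succ m ih =>
    by_cases hα : α ∈ T
    · exact hleaf hα
    obtain ⟨ρ, hρ⟩ := hT.1.1
    obtain ⟨K, hK, hKT⟩ := hT.2.2 α List.prefix_rfl
      ⟨ρ, hρ, hT.2.1 ρ hρ, fun h => hα (h ▸ hρ)⟩
    have hsub : ∀ k, ∃ S, k ∈ K → S ⊆ T ∧
        (BushyFromFor a (α ++ [k]) P S ∨ BushyFromFor b (α ++ [k]) Pᶜ S) := by
      intro k
      by_cases hk : k ∈ K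
      · obtain ⟨S, hS, h⟩ := ih (fun τ hτ => by
          have := hm τ (Finset.mem_filter.1 hτ).1
          simp only [List.length_append, List.length_singleton]
          omega) (hT.filter (hKT k hk))
        exact ⟨S, fun _ => ⟨hS.trans (Finset.filter_subset _ _), h⟩⟩
      · exact ⟨∅, fun h => absurd h hk⟩
    choose F hF using hsub
    have hcard := Finset.card_filter_add_card_filter_not (s := K)
      (fun k => BushyFromFor a (α ++ [k]) P (F k))
    by_cases hA : a ≤ (K.filter fun k => BushyFromFor a (α ++ [k]) P (F k)).card
    · refine ⟨_, Finset.biUnion_subset.2 fun k hk => (hF k (Finset.mem_filter.1 hk).1).1,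
        Or.inl (.biUnion (Finset.card_pos.1 (by omega)) hA
          fun k hk => (Finset.mem_filter.1 hk).2)⟩
    · have hB : b ≤ (K.filter fun k => ¬ BushyFromFor a (α ++ [k]) P (F k)).card := by omega
      exact ⟨_, Finset.biUnion_subset.2 fun k hk => (hF k (Finset.mem_filter.1 hk).1).1,
        Or.inr (.biUnion (Finset.card_pos.1 (by omega)) hB fun k hk =>
          (hF k (Finset.mem_filter.1 hk).1).2.resolve_left (Finset.mem_filter.1 hk).2)⟩

/-- Lemma 2 (extension of Ambos-Spies–Kjos-Hanssen–Lempp–Slaman, Lemma 2.5):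
if `T` is `(a+b-1)`-bushy from `α` and `P ⊆ T`, then some subset `S` of `T` is
`a`-bushy from `α` for `P` or `b`-bushy from `α` for `T \ P`. -/
theorem leafBag_split (a b : ℕ) (ha : 1 ≤ a) (hb : 1 ≤ b) (α : List ℕ)
    (T : Finset (List ℕ)) (hT : BushyFrom (a + b - 1) α T)
    (P : Set (List ℕ)) (hP : P ⊆ ↑T) :
    ∃ S ⊆ T, BushyFromFor a α P S ∨ BushyFromFor b α (↑T \ P) S := by
  obtain ⟨S, hST, h⟩ := hT.exists_subset_or_compl ha hb P (T.sup List.length)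
    fun τ hτ => (Finset.le_sup (f := List.length) hτ).trans (Nat.le_add_left _ _)
  exact ⟨S, hST, h.imp_right fun hS => ⟨hS.1, fun τ hτ => ⟨hST hτ, hS.2 hτ⟩⟩⟩
end

section
/- Let n ≥ 1 be a natural number, let α be a string, let J be a finite index set, and for each j ∈ J let Q_j be a set of strings; let Q = ⋃_{j ∈ J} Q_j. If there is a leaf bag which is 2^{|J|}·n-bushy from α for Q, then for some j ∈ J there is a leaf bag which is n-bushy from α for Q_j. -/
/-- `HasBushyBag n P σ`: some finite tree rooted at `σ` with leaves in `P` has at least `n`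
children at every inner node. -/
inductive HasBushyBag (n : ℕ) (P : Set (List ℕ)) : List ℕ → Prop
  | leaf {σ : List ℕ} (h : σ ∈ P) : HasBushyBag n P σ
  | node {σ : List ℕ} (S : Finset ℕ) (hS : n ≤ S.card)
      (h : ∀ k ∈ S, HasBushyBag n P (σ ++ [k])) : HasBushyBag n P σ

theorem List.exists_append_singleton_prefix {σ τ : List ℕ} (h : σ <+: τ) (hne : σ ≠ τ) :
    ∃ k, σ ++ [k] <+: τ := by
  obtain ⟨t, rfl⟩ := h
  cases t with
  | nil => simp at hne
  | cons k t => exact ⟨k, t, by simp⟩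

theorem List.eq_of_append_singleton_prefix {σ τ : List ℕ} {k l : ℕ}
    (hk : σ ++ [k] <+: τ) (hl : σ ++ [l] <+: τ) : k = l := by
  have h := (List.prefix_of_prefix_length_le hk hl (by simp)).eq_of_length (by simp)
  simpa using h

theorem bushyFromFor_singleton (n : ℕ) {P : Set (List ℕ)} {σ : List ℕ} (h : σ ∈ P) :
    BushyFromFor n σ P {σ} := by
  refine ⟨⟨⟨⟨σ, by simp⟩, by simp⟩, by simp, ?_⟩, by simpa using h⟩
  rintro τ hτ ⟨ρ, hρ, hle, hne⟩
  rw [Finset.mem_singleton] at hρ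
  subst hρ
  exact absurd (hle.eq_of_length_le hτ.length_le) hne

theorem bushyFromFor_biUnion {n : ℕ} {P : Set (List ℕ)} {σ : List ℕ} {S : Finset ℕ}
    (hne : S.Nonempty) (hS : n ≤ S.card) {T : ℕ → Finset (List ℕ)}
    (hT : ∀ k ∈ S, BushyFromFor n (σ ++ [k]) P (T k)) :
    BushyFromFor n σ P (S.biUnion T) := by
  refine ⟨⟨⟨?_, ?_⟩, ?_, ?_⟩, ?_⟩
  · obtain ⟨k, hk⟩ := hne
    obtain ⟨ρ, hρ⟩ := (hT k hk).1.1.1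
    exact ⟨ρ, Finset.mem_biUnion.2 ⟨k, hk, hρ⟩⟩
  · intro τ hτ ρ hρ hneq hle
    obtain ⟨k, hk, hτ⟩ := Finset.mem_biUnion.1 hτ
    obtain ⟨l, hl, hρ⟩ := Finset.mem_biUnion.1 hρ
    have hkl : k = l := List.eq_of_append_singleton_prefix
      (((hT k hk).1.2.1 τ hτ).trans hle) ((hT l hl).1.2.1 ρ hρ)
    subst hkl
    exact (hT k hk).1.1.2 τ hτ ρ hρ hneq hle
  · intro τ hτ
    obtain ⟨k, hk, hτ⟩ := Finset.mem_biUnion.1 hτ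
    exact (List.prefix_append _ _).trans ((hT k hk).1.2.1 τ hτ)
  · rintro τ hστ ⟨ρ, hρ, hle, hneq⟩
    by_cases hσ : σ = τ
    · subst hσ
      refine ⟨S, hS, fun k hk => ?_⟩
      obtain ⟨ρ', hρ'⟩ := (hT k hk).1.1.1
      exact ⟨ρ', Finset.mem_biUnion.2 ⟨k, hk, hρ'⟩, (hT k hk).1.2.1 ρ' hρ'⟩
    · obtain ⟨k, hk, hρ⟩ := Finset.mem_biUnion.1 hρ
      obtain ⟨l, hl⟩ := List.exists_append_singleton_prefix hστ hσ
      have hlk : l = k := List.eq_of_append_singleton_prefix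
        (hl.trans hle) ((hT k hk).1.2.1 ρ hρ)
      subst hlk
      obtain ⟨S', hS', h'⟩ := (hT l hk).1.2.2 τ hl ⟨ρ, hρ, hle, hneq⟩
      refine ⟨S', hS', fun i hi => ?_⟩
      obtain ⟨ρ', hρ', hi'⟩ := h' i hi
      exact ⟨ρ', Finset.mem_biUnion.2 ⟨l, hk, hρ'⟩, hi'⟩
  · intro τ hτ
    obtain ⟨k, hk, hτ⟩ := Finset.mem_biUnion.1 (Finset.mem_coe.1 hτ)
    exact (hT k hk).2 hτ

theorem HasBushyBag.exists_bushyFromFor {n : ℕ} (hn : 1 ≤ n) {P : Set (List ℕ)} {σ : List ℕ}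
    (h : HasBushyBag n P σ) : ∃ T : Finset (List ℕ), BushyFromFor n σ P T := by
  induction h with
  | leaf h => exact ⟨_, bushyFromFor_singleton n h⟩
  | node S hS _ ih =>
    choose! T hT using ih
    exact ⟨_, bushyFromFor_biUnion (Finset.card_pos.1 (hn.trans hS)) hS hT⟩

/-- By pigeonhole, branching `|J| * n` suffices to find an `n`-bushy subtree for a single `Q j`. -/
theorem BushyFromFor.exists_hasBushyBag {ι : Type*} {m n : ℕ} {α : List ℕ} {J : Finset ι}
    {Q : ι → Set (List ℕ)} {T : Finset (List ℕ)} (hm : J.card * n ≤ m)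
    (hT : BushyFromFor m α (⋃ j ∈ J, Q j) T) : ∃ j ∈ J, HasBushyBag n (Q j) α := by
  classical
  have hleaf : ∀ τ ∈ T, ∃ j ∈ J, τ ∈ Q j := fun τ hτ => by simpa using hT.2 hτ
  obtain ⟨⟨ρ₀, hρ₀⟩, -⟩ := hT.1.1
  obtain ⟨j₀, hj₀, -⟩ := hleaf ρ₀ hρ₀
  have key : ∀ (d : ℕ) (τ : List ℕ), T.sup List.length ≤ τ.length + d → α <+: τ →
      (∃ ρ ∈ T, τ <+: ρ) → ∃ j ∈ J, HasBushyBag n (Q j) τ := by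
    intro d
    induction d with
    | zero =>
      rintro τ hd - ⟨ρ, hρ, hle⟩
      have hlen : ρ.length ≤ T.sup List.length := Finset.le_sup hρ
      have heq : τ = ρ := hle.eq_of_length_le (by lia)
      obtain ⟨j, hj, hmem⟩ := hleaf τ (heq ▸ hρ)
      exact ⟨j, hj, .leaf hmem⟩
    | succ d ih =>
      rintro τ hd hα ⟨ρ, hρ, hle⟩
      by_cases heq : τ = ρ
      · obtain ⟨j, hj, hmem⟩ := hleaf τ (heq ▸ hρ)
        exact ⟨j, hj, .leaf hmem⟩
      · obtain ⟨S, hS, hext⟩ := hT.1.2.2 τ hα ⟨ρ, hρ, hle, heq⟩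
        have hchild : ∀ k ∈ S, ∃ j ∈ J, HasBushyBag n (Q j) (τ ++ [k]) := fun k hk =>
          ih (τ ++ [k]) (by simp only [List.length_append, List.length_singleton]; lia)
            (hα.trans (List.prefix_append _ _)) (hext k hk)
        have : Nonempty ι := ⟨j₀⟩
        choose! f hfJ hf using hchild
        obtain ⟨j, hj, hcard⟩ := Finset.exists_le_card_fiber_of_mul_le_card_of_maps_to
          hfJ ⟨j₀, hj₀⟩ (hm.trans hS)
        refine ⟨j, hj, .node _ hcard fun k hk => ?_⟩
        obtain ⟨hkS, rfl⟩ := Finset.mem_filter.1 hk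
        exact hf k hkS
  exact key _ α (Nat.le_add_left _ _) List.prefix_rfl ⟨ρ₀, hρ₀, hT.1.2.1 ρ₀ hρ₀⟩

/-- Lemma 5: if there is a `2^|J|·n`-bushy leaf bag from `α` for `Q = ⋃_{j∈J} Q_j`,
then for some `j ∈ J` there is an `n`-bushy leaf bag from `α` for `Q_j`. -/
theorem bushy_union (ι : Type*) (n : ℕ) (hn : 1 ≤ n) (α : List ℕ)
    (J : Finset ι) (Q : ι → Set (List ℕ))
    (h : ∃ T : Finset (List ℕ),
      BushyFromFor (2 ^ J.card * n) α (⋃ j ∈ J, Q j) T) :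
    ∃ j ∈ J, ∃ T : Finset (List ℕ), BushyFromFor n α (Q j) T := by
  obtain ⟨T, hT⟩ := h
  obtain ⟨j, hj, hbag⟩ := hT.exists_hasBushyBag (Nat.mul_le_mul_right n Nat.lt_two_pow_self.le)
  exact ⟨j, hj, hbag.exists_bushyFromFor hn⟩
end
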